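/- Let A be an integer (r,s)×t bimatrix and let x be a feasible point of the n-fold integer program with objective w and finite bounds l, u. Then there exist a positive integer γ and a vector g = (g¹,…,gⁿ) ∈ ℤ^{nt} such that: every brick gⁱ lies in Z(A); every partial sum Σ_{j≤i} gʲ lies in Z(A); A₁·(Σ_{i=1}^n gⁱ) = 0; x + γg is feasible; w·(x+γg) ≤ w·x; and w·(x+γg) ≤ w·(x+γ̄ḡ) for every positive integer γ̄ and every ḡ ∈ 𝒢(A⁽ⁿ⁾) with l ≤ x + γ̄ḡ ≤ u. -/

import Mathlib

open Matrix

/-- The conformal (sign-compatible) partial order `x ⊑ y` on integer vectors: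
`x k * y k ≥ 0` and `|x k| ≤ |y k|` for every coordinate `k`. -/
def ConformalLe {ν : Type*} (x y : ν → ℤ) : Prop :=
  ∀ k, 0 ≤ x k * y k ∧ |x k| ≤ |y k|

/-- The Graver basis of an integer matrix `A`: the set of `⊑`-minimal elements of
`{x : A x = 0, x ≠ 0}`. -/
def GraverBasis {μ ν : Type*} [Fintype ν] (A : Matrix μ ν ℤ) : Set (ν → ℤ) :=
  {x | A.mulVec x = 0 ∧ x ≠ 0 ∧
    ∀ y, A.mulVec y = 0 → y ≠ 0 → ConformalLe y x → y = x}

/-- The `ι`-fold product of the bimatrix with blocks `A1` (first block, `r × τ`) and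
`A2` (second block, `s × τ`): the first `r` rows are `(A1 A1 ⋯ A1)` and the remaining
rows form a block-diagonal matrix with a copy of `A2` for each index in `ι`. -/
def nFold {r s : ℕ} {τ : Type*} (A1 : Matrix (Fin r) τ ℤ) (A2 : Matrix (Fin s) τ ℤ)
    (ι : Type*) [DecidableEq ι] : Matrix (Fin r ⊕ ι × Fin s) (ι × τ) ℤ :=
  Matrix.of fun i jt =>
    match i with
    | Sum.inl a => A1 a jt.2
    | Sum.inr (k, c) => if jt.1 = k then A2 c jt.2 else 0

/-- The `i`-th brick of a vector indexed by `ι × τ`. -/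
def brick {ι τ : Type*} (x : ι × τ → ℤ) (i : ι) : τ → ℤ := fun j => x (i, j)

/-- The Graver complexity of the bimatrix `(A1, A2)`: the largest number of nonzero
bricks appearing in any element of the Graver basis of any `n`-fold product. -/
noncomputable def graverComplexity {r s t : ℕ} (A1 : Matrix (Fin r) (Fin t) ℤ)
    (A2 : Matrix (Fin s) (Fin t) ℤ) : ℕ :=
  sSup {k : ℕ | ∃ (n : ℕ) (g : Fin n × Fin t → ℤ),
    g ∈ GraverBasis (nFold A1 A2 (Fin n)) ∧
    k = {i : Fin n | brick g i ≠ 0}.ncard}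

/-- `Z(A)`: the set of all vectors in `ℤ^t` that are sums of at most `g(A)` elements
of the Graver basis of `A2`. -/
noncomputable def ZSet {r s t : ℕ} (A1 : Matrix (Fin r) (Fin t) ℤ)
    (A2 : Matrix (Fin s) (Fin t) ℤ) : Set (Fin t → ℤ) :=
  {z | ∃ L : List (Fin t → ℤ), L.length ≤ graverComplexity A1 A2 ∧
    (∀ h ∈ L, h ∈ GraverBasis A2) ∧ z = L.sum}

section Conformal

variable {ν : Type*}

theorem conformalLe_iff {x y : ν → ℤ} :
    ConformalLe x y ↔ ∀ k, (0 ≤ x k ∧ x k ≤ y k) ∨ (y k ≤ x k ∧ x k ≤ 0) := by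
  refine forall_congr' fun k => ?_
  constructor
  · rintro ⟨h1, h2⟩
    rcases lt_trichotomy (y k) 0 with hy | hy | hy
    · have hx : x k ≤ 0 := by
        by_contra! hx
        nlinarith
      rw [abs_of_nonpos hx, abs_of_neg hy] at h2
      right; omega
    · rw [hy, abs_zero] at h2
      have := abs_nonpos_iff.mp h2
      left; omega
    · have hx : 0 ≤ x k := by
        by_contra! hx
        nlinarith
      rw [abs_of_nonneg hx, abs_of_pos hy] at h2
      left; omega
  · rintro (⟨h1, h2⟩ | ⟨h1, h2⟩)
    · exact ⟨mul_nonneg h1 (h1.trans h2), abs_le_abs_of_nonneg h1 h2⟩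
    · exact ⟨mul_nonneg_of_nonpos_of_nonpos h2 (h1.trans h2), abs_le_abs_of_nonpos h2 h1⟩

theorem ConformalLe.refl (x : ν → ℤ) : ConformalLe x x :=
  fun _ => ⟨mul_self_nonneg _, le_rfl⟩

theorem ConformalLe.zero (x : ν → ℤ) : ConformalLe 0 x := fun k => by simp

theorem ConformalLe.trans {x y z : ν → ℤ} (hxy : ConformalLe x y) (hyz : ConformalLe y z) :
    ConformalLe x z := by
  rw [conformalLe_iff] at *
  intro k
  have := hxy k
  have := hyz k
  omega

theorem ConformalLe.sub_left {x y : ν → ℤ} (h : ConformalLe x y) : ConformalLe (y - x) y := by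
  rw [conformalLe_iff] at *
  intro k
  have := h k
  simp only [Pi.sub_apply]
  omega

theorem ConformalLe.sum_natAbs_lt [Fintype ν] {x y : ν → ℤ} (h : ConformalLe x y)
    (hne : x ≠ y) : ∑ k, (x k).natAbs < ∑ k, (y k).natAbs := by
  obtain ⟨k, hk⟩ := Function.ne_iff.mp hne
  rw [conformalLe_iff] at h
  refine Finset.sum_lt_sum (fun i _ => ?_) ⟨k, Finset.mem_univ k, ?_⟩
  · have := h i
    omega
  · have := h k
    omega

instance : IsPreorder (ν → ℤ) ConformalLe where
  refl := ConformalLe.refl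
  trans _ _ _ := ConformalLe.trans

/-- Dickson's lemma for the conformal order. -/
theorem partiallyWellOrderedOn_conformalLe [Finite ν] (s : Set (ν → ℤ)) :
    s.PartiallyWellOrderedOn ConformalLe := by
  rw [Set.partiallyWellOrderedOn_iff_exists_lt]
  intro f _
  obtain ⟨m, n, hmn, h⟩ := wellQuasiOrdered_le (α := ν → ℕ × ℕ)
    fun i k => ((f i k).toNat, (-(f i k)).toNat)
  refine ⟨m, n, hmn, conformalLe_iff.mpr fun k => ?_⟩
  have h1 : (f m k).toNat ≤ (f n k).toNat := (h k).1
  have h2 : (-(f m k)).toNat ≤ (-(f n k)).toNat := (h k).2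
  omega

/-- Every integer vector in the kernel of `A` is a conformal sum of Graver basis elements. -/
theorem exists_graverBasis_list {μ : Type*} [Fintype ν] (A : Matrix μ ν ℤ) (y : ν → ℤ)
    (hy : A.mulVec y = 0) :
    ∃ L : List (ν → ℤ), (∀ h ∈ L, h ∈ GraverBasis A ∧ ConformalLe h y) ∧ L.sum = y := by
  induction hm : ∑ k, (y k).natAbs using Nat.strong_induction_on generalizing y with
  | _ m ih =>
    subst hm
    by_cases h0 : y = 0
    · exact ⟨[], by simp, by simp [h0]⟩
    by_cases hg : y ∈ GraverBasis A
    · exact ⟨[y], by simpa using ⟨hg, ConformalLe.refl y⟩, by simp⟩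
    have : ∃ z, A.mulVec z = 0 ∧ z ≠ 0 ∧ ConformalLe z y ∧ z ≠ y := by
      by_contra! hc
      exact hg ⟨hy, h0, hc⟩
    obtain ⟨z, hz, hz0, hzy, hne⟩ := this
    obtain ⟨L₁, hL₁, hs₁⟩ := ih _ (hzy.sum_natAbs_lt hne) z hz rfl
    have hne' : y - z ≠ y := by simpa using hz0
    obtain ⟨L₂, hL₂, hs₂⟩ := ih _ (hzy.sub_left.sum_natAbs_lt hne') (y - z)
      (by rw [Matrix.mulVec_sub, hy, hz, sub_zero]) rfl
    refine ⟨L₁ ++ L₂, fun h hh => ?_, by simp [hs₁, hs₂]⟩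
    rcases List.mem_append.mp hh with hh | hh
    · exact ⟨(hL₁ h hh).1, (hL₁ h hh).2.trans hzy⟩
    · exact ⟨(hL₂ h hh).1, (hL₂ h hh).2.trans hzy.sub_left⟩

end Conformal

section NFold

variable {r s : ℕ} {τ ι κ : Type*} [Fintype τ] [Fintype ι] [DecidableEq ι] [Fintype κ]
  [DecidableEq κ] {A1 : Matrix (Fin r) τ ℤ} {A2 : Matrix (Fin s) τ ℤ}

theorem nFold_mulVec_eq_zero_iff {x : ι × τ → ℤ} :
    (nFold A1 A2 ι).mulVec x = 0 ↔
      A1.mulVec (∑ i, brick x i) = 0 ∧ ∀ i, A2.mulVec (brick x i) = 0 := by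
  have h1 : ∀ a, (nFold A1 A2 ι).mulVec x (Sum.inl a) = A1.mulVec (∑ i, brick x i) a := by
    intro a
    simp only [Matrix.mulVec, dotProduct, nFold, brick, Fintype.sum_prod_type, Finset.sum_apply,
      Finset.mul_sum, Matrix.of_apply]
    exact Finset.sum_comm
  have h2 : ∀ k c, (nFold A1 A2 ι).mulVec x (Sum.inr (k, c)) = A2.mulVec (brick x k) c := by
    intro k c
    simp [Matrix.mulVec, dotProduct, nFold, brick, Fintype.sum_prod_type]
  constructor
  · intro h
    refine ⟨funext fun a => ?_, fun k => funext fun c => ?_⟩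
    · rw [← h1, h]; rfl
    · rw [← h2, h]; rfl
  · rintro ⟨ha, hb⟩
    funext p
    rcases p with a | ⟨k, c⟩
    · rw [h1, ha]; rfl
    · rw [h2, hb]; rfl

/-- Splitting the bricks of a Graver basis element conformally into elements of the kernel of
`A2` gives a Graver basis element of a larger product. -/
theorem mem_graverBasis_nFold_of_refinement (f : κ → ι) {g : ι × τ → ℤ} {G : κ × τ → ℤ}
    (hg : g ∈ GraverBasis (nFold A1 A2 ι)) (hG : ∀ k, A2.mulVec (brick G k) = 0)
    (hc : ∀ k, ConformalLe (brick G k) (brick g (f k)))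
    (hs : ∀ i, ∑ k with f k = i, brick G k = brick g i) :
    G ∈ GraverBasis (nFold A1 A2 κ) := by
  obtain ⟨hg1, hg2, hg3⟩ := hg
  rw [nFold_mulVec_eq_zero_iff] at hg1
  refine ⟨nFold_mulVec_eq_zero_iff.mpr ⟨?_, hG⟩, ?_, ?_⟩
  · rw [← Finset.sum_fiberwise Finset.univ f]
    simp only [hs]
    exact hg1.1
  · rintro rfl
    refine hg2 (funext fun p => ?_)
    have := congrFun (hs p.1) p.2
    simpa [brick, Finset.sum_apply] using this.symm
  · intro y hy hy0 hyG
    rw [nFold_mulVec_eq_zero_iff] at hy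
    rw [conformalLe_iff] at hyG
    have hs' : ∀ i j, ∑ k with f k = i, G (k, j) = g (i, j) := by
      intro i j
      simpa [brick, Finset.sum_apply] using congrFun (hs i) j
    have key : ∀ i j, (∀ k ∈ Finset.univ.filter (f · = i), 0 ≤ y (k, j) ∧ y (k, j) ≤ G (k, j)) ∨
        (∀ k ∈ Finset.univ.filter (f · = i), G (k, j) ≤ y (k, j) ∧ y (k, j) ≤ 0) := by
      intro i j
      have hk : ∀ k, f k = i → (0 ≤ G (k, j) ∧ G (k, j) ≤ g (i, j)) ∨
          (g (i, j) ≤ G (k, j) ∧ G (k, j) ≤ 0) := by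
        rintro k rfl
        exact conformalLe_iff.mp (hc k) j
      rcases le_total 0 (g (i, j)) with h | h
      · left
        intro k hki
        have := hk k (Finset.mem_filter.mp hki).2
        have := hyG (k, j)
        omega
      · right
        intro k hki
        have := hk k (Finset.mem_filter.mp hki).2
        have := hyG (k, j)
        omega
    set y' : ι × τ → ℤ := fun p => ∑ k with f k = p.1, y (k, p.2) with hy'
    have hb : ∀ i, brick y' i = ∑ k with f k = i, brick y k := by
      intro i
      funext j
      simp [brick, hy', Finset.sum_apply]
    have hker : (nFold A1 A2 ι).mulVec y' = 0 := by
      refine nFold_mulVec_eq_zero_iff.mpr ⟨?_, fun i => ?_⟩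
      · simp only [hb]
        rw [Finset.sum_fiberwise Finset.univ f]
        exact hy.1
      · rw [hb, Matrix.mulVec_sum]
        exact Finset.sum_eq_zero fun k _ => hy.2 k
    have hconf : ConformalLe y' g := by
      refine conformalLe_iff.mpr fun ⟨i, j⟩ => ?_
      rcases key i j with h | h
      · left
        exact ⟨Finset.sum_nonneg fun k hk => (h k hk).1,
          (Finset.sum_le_sum fun k hk => (h k hk).2).trans_eq (hs' i j)⟩
      · right
        exact ⟨(hs' i j).symm.trans_le (Finset.sum_le_sum fun k hk => (h k hk).1),
          Finset.sum_nonpos fun k hk => (h k hk).2⟩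
    have hne : y' ≠ 0 := by
      intro h0
      refine hy0 (funext fun ⟨k, j⟩ => ?_)
      have hz : ∑ k' with f k' = f k, y (k', j) = 0 := congrFun h0 (f k, j)
      rcases key (f k) j with h | h
      · exact (Finset.sum_eq_zero_iff_of_nonneg fun k hk => (h k hk).1).mp hz k (by simp)
      · exact (Finset.sum_eq_zero_iff_of_nonpos fun k hk => (h k hk).2).mp hz k (by simp)
    have heq := hg3 y' hker hne hconf
    funext ⟨k, j⟩
    have hz : ∑ k' with f k' = f k, y (k', j) = ∑ k' with f k' = f k, G (k', j) :=
      (congrFun heq (f k, j)).trans (hs' _ _).symm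
    rcases key (f k) j with h | h
    · exact (Finset.sum_eq_sum_iff_of_le fun k hk => (h k hk).2).mp hz k (by simp)
    · exact ((Finset.sum_eq_sum_iff_of_le fun k hk => (h k hk).1).mp hz.symm k (by simp)).symm

end NFold

section Complexity

variable {r s t : ℕ} {A1 : Matrix (Fin r) (Fin t) ℤ} {A2 : Matrix (Fin s) (Fin t) ℤ}

theorem List.SublistForall₂.exists_forall₂_filter {α : Type*} {R : α → α → Prop} {z : α}
    [DecidableEq α] (hz : ∀ a, R z a) {l l' : List α} (h : List.SublistForall₂ R l l')
    (hl : ∀ a ∈ l, a ≠ z) :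
    ∃ m, List.Forall₂ R m l' ∧ m.filter (· ≠ z) = l := by
  induction h with
  | @nil l' =>
    refine ⟨l'.map fun _ => z, ?_, by simp⟩
    rw [List.forall₂_map_left_iff]
    exact List.forall₂_same.mpr fun a _ => hz a
  | @cons a b _ _ hab _ ih =>
    obtain ⟨m, h1, h2⟩ := ih fun a ha => hl a (List.mem_cons_of_mem _ ha)
    exact ⟨a :: m, .cons hab h1, by rw [List.filter_cons_of_pos (by simpa using hl a), h2]⟩
  | cons_right _ ih =>
    obtain ⟨m, h1, h2⟩ := ih hl
    exact ⟨z :: m, .cons (hz _) h1, by simpa using h2⟩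

/-- The list of nonzero bricks of a vector. -/
def nonzeroBricks {n t : ℕ} (g : Fin n × Fin t → ℤ) : List (Fin t → ℤ) :=
  (List.ofFn (brick g)).filter (· ≠ 0)

theorem length_nonzeroBricks {n : ℕ} (g : Fin n × Fin t → ℤ) :
    (nonzeroBricks g).length = {i : Fin n | brick g i ≠ 0}.ncard := by
  rw [nonzeroBricks, List.ofFn_eq_map, List.filter_map, List.length_map,
    ← List.toFinset_card_of_nodup ((List.nodup_finRange n).filter _),
    ← Set.ncard_coe_finset]
  congr 1
  ext i
  simp

theorem sum_filter_ne_zero {M : Type*} [AddMonoid M] [DecidableEq M] (l : List M) :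
    (l.filter (· ≠ 0)).sum = l.sum := by
  induction l with
  | nil => rfl
  | cons a l ih =>
    by_cases h : a = 0
    · simpa [h] using ih
    · rw [List.filter_cons_of_pos (by simpa using h), List.sum_cons, List.sum_cons, ih]

theorem nonzeroBricks_eq_of_sublistForall₂ {n n' : ℕ} {g : Fin n × Fin t → ℤ}
    {g' : Fin n' × Fin t → ℤ} (hg : g ∈ GraverBasis (nFold A1 A2 (Fin n)))
    (hg' : g' ∈ GraverBasis (nFold A1 A2 (Fin n')))
    (h : List.SublistForall₂ ConformalLe (nonzeroBricks g) (nonzeroBricks g')) :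
    nonzeroBricks g = nonzeroBricks g' := by
  have h' : List.SublistForall₂ ConformalLe (nonzeroBricks g) (List.ofFn (brick g')) := by
    obtain ⟨l, hl, hsub⟩ := List.sublistForall₂_iff.mp h
    exact List.sublistForall₂_iff.mpr ⟨l, hl, hsub.trans List.filter_sublist⟩
  obtain ⟨m, hm, hmg⟩ := h'.exists_forall₂_filter ConformalLe.zero (z := 0)
    fun a ha => by simpa using (List.mem_filter.mp ha).2
  have hlen : m.length = n' := by simpa using hm.length_eq
  subst hlen
  set y : Fin m.length × Fin t → ℤ := fun p => m[p.1] p.2 with hy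
  have hym : List.ofFn (brick y) = m := List.ofFn_getElem
  have hyg : nonzeroBricks y = nonzeroBricks g := by rw [nonzeroBricks, hym, hmg]
  have hsum : ∀ {k : ℕ} (v : Fin k × Fin t → ℤ), ∑ i, brick v i = (nonzeroBricks v).sum := by
    intro k v
    rw [nonzeroBricks, sum_filter_ne_zero, List.sum_ofFn]
  obtain ⟨hk1, hk2⟩ := nFold_mulVec_eq_zero_iff.mp hg.1
  have hyeq : y = g' := by
    refine hg'.2.2 y (nFold_mulVec_eq_zero_iff.mpr ⟨?_, fun i => ?_⟩) ?_ ?_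
    · rw [hsum, hyg, ← hsum, hk1]
    · by_cases h0 : brick y i = 0
      · rw [h0, Matrix.mulVec_zero]
      have hmem : brick y i ∈ nonzeroBricks y := by
        simpa [nonzeroBricks, List.mem_filter, List.mem_ofFn] using h0
      rw [hyg, nonzeroBricks, List.mem_filter, List.mem_ofFn] at hmem
      obtain ⟨⟨k, hk⟩, -⟩ := hmem
      rw [← hk, hk2]
    · intro h0
      have hnil : nonzeroBricks g = [] := by
        rw [← hyg, h0, nonzeroBricks, List.filter_eq_nil_iff]
        intro a ha
        obtain ⟨i, rfl⟩ := List.mem_ofFn.mp ha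
        simp [brick, funext_iff]
      refine hg.2.1 (funext fun ⟨i, j⟩ => ?_)
      rw [nonzeroBricks, List.filter_eq_nil_iff] at hnil
      have := hnil (brick g i) (List.mem_ofFn.mpr ⟨i, rfl⟩)
      simp only [ne_eq, decide_not, Bool.not_eq_eq_eq_not, Bool.not_true,
        decide_eq_false_iff_not, not_not] at this
      exact congrFun this j
    · rintro ⟨i, j⟩
      have := hm.get i.2 (by simp)
      simpa [brick, hy] using this j
  rw [← hyg, hyeq]

/-- The Graver complexity is a genuine maximum: the numbers of nonzero bricks are bounded. -/
theorem bddAbove_nonzero_bricks (A1 : Matrix (Fin r) (Fin t) ℤ) (A2 : Matrix (Fin s) (Fin t) ℤ) :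
    BddAbove {k : ℕ | ∃ (n : ℕ) (g : Fin n × Fin t → ℤ),
      g ∈ GraverBasis (nFold A1 A2 (Fin n)) ∧
      k = {i : Fin n | brick g i ≠ 0}.ncard} := by
  set S : Set (List (Fin t → ℤ)) := {L | ∃ (n : ℕ) (g : Fin n × Fin t → ℤ),
    g ∈ GraverBasis (nFold A1 A2 (Fin n)) ∧ nonzeroBricks g = L}
  have hanti : IsAntichain (List.SublistForall₂ ConformalLe) S := by
    rintro _ ⟨n, g, hg, rfl⟩ _ ⟨n', g', hg', rfl⟩ hne hle
    exact hne (nonzeroBricks_eq_of_sublistForall₂ hg hg' hle)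
  have hfin : S.Finite := hanti.finite_of_partiallyWellOrderedOn
    (((partiallyWellOrderedOn_conformalLe
      Set.univ).partiallyWellOrderedOn_sublistForall₂ ConformalLe).mono fun _ _ _ _ => trivial)
  refine ((hfin.image List.length).bddAbove).mono ?_
  rintro _ ⟨n, g, hg, rfl⟩
  exact ⟨_, ⟨n, g, hg, rfl⟩, length_nonzeroBricks g⟩

theorem card_le_graverComplexity {κ : Type*} [Fintype κ] [DecidableEq κ] {G : κ × Fin t → ℤ}
    (hG : G ∈ GraverBasis (nFold A1 A2 κ)) (h0 : ∀ k, brick G k ≠ 0) :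
    Fintype.card κ ≤ graverComplexity A1 A2 := by
  let e := (Fintype.equivFin κ).symm
  refine le_csSup (bddAbove_nonzero_bricks A1 A2)
    ⟨Fintype.card κ, fun p => G (e p.1, p.2), ?_, ?_⟩
  · refine mem_graverBasis_nFold_of_refinement e hG
      (fun k => (nFold_mulVec_eq_zero_iff.mp hG.1).2 (e k)) (fun k => ConformalLe.refl _) ?_
    intro i
    rw [Finset.sum_eq_single_of_mem (e.symm i) (by simp)]
    · funext j
      simp [brick]
    · intro k hk hne
      exact absurd (e.eq_symm_apply.mpr (Finset.mem_filter.mp hk).2) hne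
  · have : {i | brick (fun p : Fin (Fintype.card κ) × Fin t => G (e p.1, p.2)) i ≠ 0}
        = Set.univ := Set.eq_univ_of_forall fun i => h0 (e i)
    rw [this, Set.ncard_univ, Nat.card_eq_fintype_card, Fintype.card_fin]

/-- Every sum of bricks of a Graver basis element of an `n`-fold product lies in `Z(A)`. -/
theorem sum_brick_mem_ZSet {ι : Type*} [Fintype ι] [DecidableEq ι] {g : ι × Fin t → ℤ}
    (hg : g ∈ GraverBasis (nFold A1 A2 ι)) (I : Finset ι) :
    ∑ i ∈ I, brick g i ∈ ZSet A1 A2 := by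
  choose L hL hsum using fun i =>
    exists_graverBasis_list A2 (brick g i) ((nFold_mulVec_eq_zero_iff.mp hg.1).2 i)
  let G : (Σ i, Fin (L i).length) × Fin t → ℤ := fun p => (L p.1.1)[p.1.2] p.2
  have hbG : ∀ k, brick G k = (L k.1)[k.2] := fun k => rfl
  have hmem : ∀ k, brick G k ∈ GraverBasis A2 ∧ ConformalLe (brick G k) (brick g k.1) :=
    fun k => hL k.1 (brick G k) (hbG k ▸ List.getElem_mem k.2.isLt)
  have hG : G ∈ GraverBasis (nFold A1 A2 (Σ i, Fin (L i).length)) := by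
    refine mem_graverBasis_nFold_of_refinement Sigma.fst hg (fun k => (hmem k).1.1)
      (fun k => (hmem k).2) fun i => ?_
    rw [Finset.sum_filter, Fintype.sum_sigma, Finset.sum_eq_single_of_mem i (Finset.mem_univ i)]
    · simp only [if_true, hbG]
      rw [← hsum i]
      exact Fin.sum_univ_getElem (L i)
    · intro j _ hj
      simp [hj]
  have hcard := card_le_graverComplexity hG fun k => (hmem k).1.2.1
  rw [Fintype.card_sigma] at hcard
  simp only [Fintype.card_fin] at hcard
  refine ⟨I.toList.flatMap L, ?_, ?_, ?_⟩
  · rw [List.length_flatMap, Finset.sum_map_toList]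
    exact (Finset.sum_le_univ_sum_of_nonneg fun _ => Nat.zero_le _).trans hcard
  · intro h hh
    obtain ⟨i, -, hi⟩ := List.mem_flatMap.mp hh
    exact (hL i h hi).1
  · rw [List.flatMap, List.sum_flatten, List.map_map, ← Finset.sum_map_toList]
    congr 2
    funext i
    exact (hsum i).symm

end Complexity

/-- Given a feasible point `x` of the `n`-fold integer program, there
exist a positive integer `γ` and a vector `g` all of whose bricks and partial brick
sums lie in `Z(A)`, with `A₁ (∑ᵢ gⁱ) = 0`, such that `x + γ g` is feasible, not worse
than `x`, and at least as good as `x + γ̄ ḡ` for every positive integer `γ̄` and every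
`ḡ ∈ 𝒢(A⁽ⁿ⁾)` with `x + γ̄ ḡ` within the bounds (a Graver-best step). -/
theorem exists_graver_best_step {r s t n : ℕ}
    (A1 : Matrix (Fin r) (Fin t) ℤ) (A2 : Matrix (Fin s) (Fin t) ℤ)
    (w l u : Fin n × Fin t → ℤ) (b : Fin r ⊕ Fin n × Fin s → ℤ)
    (x : Fin n × Fin t → ℤ)
    (hxb : (nFold A1 A2 (Fin n)).mulVec x = b) (hxl : l ≤ x) (hxu : x ≤ u) :
    ∃ (γ : ℕ) (g : Fin n × Fin t → ℤ), 0 < γ ∧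
      (∀ i, brick g i ∈ ZSet A1 A2) ∧
      (∀ i : Fin n, (fun j => ∑ i' ∈ Finset.univ.filter (· ≤ i), g (i', j))
          ∈ ZSet A1 A2) ∧
      A1.mulVec (fun j => ∑ i, brick g i j) = 0 ∧
      (nFold A1 A2 (Fin n)).mulVec (x + (γ : ℤ) • g) = b ∧
      l ≤ x + (γ : ℤ) • g ∧ x + (γ : ℤ) • g ≤ u ∧
      w ⬝ᵥ (x + (γ : ℤ) • g) ≤ w ⬝ᵥ x ∧
      ∀ (γbar : ℕ), 0 < γbar → ∀ gbar ∈ GraverBasis (nFold A1 A2 (Fin n)),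
        l ≤ x + (γbar : ℤ) • gbar → x + (γbar : ℤ) • gbar ≤ u →
        w ⬝ᵥ (x + (γ : ℤ) • g) ≤ w ⬝ᵥ (x + (γbar : ℤ) • gbar) := by
  set F : Set (Fin n × Fin t → ℤ) := {z | ∃ (γ : ℕ) (g : Fin n × Fin t → ℤ), 0 < γ ∧
    (g = 0 ∨ g ∈ GraverBasis (nFold A1 A2 (Fin n))) ∧ z = x + (γ : ℤ) • g ∧ l ≤ z ∧ z ≤ u}
    with hF
  have hfin : F.Finite := (Set.finite_Icc l u).subset fun z ⟨_, _, _, _, _, h⟩ => h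
  have hx : x ∈ F := ⟨1, 0, one_pos, Or.inl rfl, by simp, hxl, hxu⟩
  obtain ⟨z, ⟨γ, g, hγ, hg, rfl, hl, hu⟩, hmin⟩ := hfin.exists_minimalFor (w ⬝ᵥ ·) F ⟨x, hx⟩
  have hmin' : ∀ z ∈ F, w ⬝ᵥ (x + (γ : ℤ) • g) ≤ w ⬝ᵥ z := fun z hz =>
    (le_total _ _).elim id (hmin hz)
  have hker : (nFold A1 A2 (Fin n)).mulVec g = 0 := by
    rcases hg with rfl | hg
    · exact Matrix.mulVec_zero _
    · exact hg.1
  have hZ : ∀ I : Finset (Fin n), ∑ i ∈ I, brick g i ∈ ZSet A1 A2 := by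
    intro I
    rcases hg with rfl | hg
    · exact ⟨[], by simp, by simp, Finset.sum_eq_zero fun _ _ => rfl⟩
    · exact sum_brick_mem_ZSet hg I
  refine ⟨γ, g, hγ, fun i => by simpa using hZ {i}, fun i => ?_, ?_, ?_, hl, hu, hmin' x hx,
    fun γbar hγbar gbar hgbar hl' hu' =>
      hmin' _ ⟨γbar, gbar, hγbar, Or.inr hgbar, rfl, hl', hu'⟩⟩
  · convert hZ (Finset.univ.filter (· ≤ i)) using 1
    funext j
    simp [brick, Finset.sum_apply]
  · convert (nFold_mulVec_eq_zero_iff.mp hker).1 using 2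
    funext j
    simp [Finset.sum_apply]
  · rw [Matrix.mulVec_add, Matrix.mulVec_smul, hker, hxb, smul_zero, add_zero]
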